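/- arXiv:2206.08235 — 9 statements merged into one kernel-verified Lean document; each statement's English description precedes it below -/
import Mathlib

section
/- Let Θ be a nonempty set, m ≥ 1, J ≥ 3, and let π : Θ → Fin m → Fin J → ℝ satisfy 0 < π θ i j and Σ_{j} π θ i j = 1 for every θ ∈ Θ and every i. Let Y : Fin m → Fin J → ℝ be nonnegative counts and let σ₁, σ₂ be permutations of Fin J. Suppose that for every θ₁ ∈ Θ there exists θ₂ ∈ Θ with π θ₁ i (σ₁⁻¹ j) = π θ₂ i (σ₂⁻¹ j) for all i, j, and conversely for every θ₂ ∈ Θ there exists θ₁ ∈ Θ with the same identities. Then for every permutation σ of Fin J, ⨆_{θ∈Θ} l_{σ∘σ₁}(θ) = ⨆_{θ∈Θ} l_{σ∘σ₂}(θ); in particular (taking σ = id) the orders σ₁ and σ₂ are equivalent. -/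
/-- If the category probabilities under orders `σ₁` and `σ₂` can be matched by a
correspondence of parameters, then for every permutation `σ`, the suprema of the reduced
log-likelihoods under orders `σ ∘ σ₁` and `σ ∘ σ₂` coincide; in particular `σ₁ ∼ σ₂`. -/
theorem order_equivalence_of_prob_correspondence
    {Θ : Type*} [Nonempty Θ] (m J : ℕ) (hm : 1 ≤ m) (hJ : 3 ≤ J)
    (π : Θ → Fin m → Fin J → ℝ)
    (hpos : ∀ (θ : Θ) (i : Fin m) (j : Fin J), 0 < π θ i j)
    (hsum : ∀ (θ : Θ) (i : Fin m), ∑ j, π θ i j = 1)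
    (Y : Fin m → Fin J → ℝ) (hY : ∀ i j, 0 ≤ Y i j)
    (σ₁ σ₂ : Equiv.Perm (Fin J))
    (h12 : ∀ θ₁ : Θ, ∃ θ₂ : Θ, ∀ (i : Fin m) (j : Fin J),
      π θ₁ i (σ₁⁻¹ j) = π θ₂ i (σ₂⁻¹ j))
    (h21 : ∀ θ₂ : Θ, ∃ θ₁ : Θ, ∀ (i : Fin m) (j : Fin J),
      π θ₁ i (σ₁⁻¹ j) = π θ₂ i (σ₂⁻¹ j)) :
    ∀ σ : Equiv.Perm (Fin J),
      (⨆ θ : Θ, ∑ i, ∑ j, Y i ((σ * σ₁) j) * Real.log (π θ i j)) =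
      (⨆ θ : Θ, ∑ i, ∑ j, Y i ((σ * σ₂) j) * Real.log (π θ i j)) := by
  intro σ
  have key : ∀ (τ : Equiv.Perm (Fin J)) (θ : Θ),
      ∑ i, ∑ j, Y i ((σ * τ) j) * Real.log (π θ i j) =
      ∑ i, ∑ j, Y i (σ j) * Real.log (π θ i (τ⁻¹ j)) := by
    intro τ θ
    refine Finset.sum_congr rfl fun i _ => ?_
    rw [← Equiv.sum_comp τ (fun j => Y i (σ j) * Real.log (π θ i (τ⁻¹ j)))]
    simp
  simp only [key]
  unfold iSup
  congr 1
  ext x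
  constructor
  · rintro ⟨θ₁, rfl⟩
    obtain ⟨θ₂, h⟩ := h12 θ₁
    exact ⟨θ₂, by simp only [h]⟩
  · rintro ⟨θ₂, rfl⟩
    obtain ⟨θ₁, h⟩ := h21 θ₂
    exact ⟨θ₁, by simp only [h]⟩
end

section
/- Consider the baseline-category ppo model with common predictor vectors, with parameter space Θ = (ℝ^q)^{J−1} × ℝ^r (all parameter tuples). Let Y : Fin m → Fin J → ℝ be nonnegative counts. Then for any two permutations σ₁, σ₂ of {1,…,J} with σ₁(J) = J and σ₂(J) = J, ⨆_{θ∈Θ} l_{σ₁}(θ) = ⨆_{θ∈Θ} l_{σ₂}(θ); that is, all orders of the response categories that keep the baseline category J invariant are equivalent. -/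
/-- Linear predictor of the baseline-category ppo model with common predictor vectors. -/
noncomputable def bppoEta (m K q r : ℕ) (a : Fin m → Fin q → ℝ) (b : Fin m → Fin r → ℝ)
    (β : Fin K → Fin q → ℝ) (ζ : Fin r → ℝ) (i : Fin m) (j : Fin K) : ℝ :=
  (∑ x, a i x * β j x) + ∑ x, b i x * ζ x

/-- Category probabilities of the baseline-category ppo model (`J = K + 1` categories). -/
noncomputable def bppoPi (m K q r : ℕ) (a : Fin m → Fin q → ℝ) (b : Fin m → Fin r → ℝ)
    (β : Fin K → Fin q → ℝ) (ζ : Fin r → ℝ) (i : Fin m) (c : Fin (K + 1)) : ℝ :=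
  (if h : (c : ℕ) < K then Real.exp (bppoEta m K q r a b β ζ i ⟨c, h⟩) else 1) /
    (1 + ∑ l, Real.exp (bppoEta m K q r a b β ζ i l))

theorem bppo_aux_perm (K : ℕ) (σ : Equiv.Perm (Fin (K + 1)))
    (h : σ (Fin.last K) = Fin.last K) :
    ∃ ρ : Equiv.Perm (Fin K), ∀ j, σ j.castSucc = (ρ j).castSucc := by
  have hne : ∀ j : Fin K, σ j.castSucc ≠ Fin.last K := by
    intro j hj
    exact (Fin.castSucc_lt_last j).ne (σ.injective (hj.trans h.symm))
  let f : Fin K → Fin K := fun j => (σ j.castSucc).castPred (hne j)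
  have hf : ∀ j, (f j).castSucc = σ j.castSucc := fun j => Fin.castSucc_castPred _ _
  have hinj : Function.Injective f := by
    intro x y hxy
    have h2 : σ x.castSucc = σ y.castSucc := by rw [← hf, ← hf, hxy]
    exact Fin.castSucc_injective _ (σ.injective h2)
  exact ⟨Equiv.ofBijective f (Finite.injective_iff_bijective.mp hinj), fun j => (hf j).symm⟩

theorem bppo_aux_sup (m K q r : ℕ)
    (a : Fin m → Fin q → ℝ) (b : Fin m → Fin r → ℝ)
    (Y : Fin m → Fin (K + 1) → ℝ) (σ : Equiv.Perm (Fin (K + 1)))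
    (h : σ (Fin.last K) = Fin.last K) :
    (⨆ p : (Fin K → Fin q → ℝ) × (Fin r → ℝ),
        ∑ i, ∑ j, Y i (σ j) * Real.log (bppoPi m K q r a b p.1 p.2 i j)) =
    (⨆ p : (Fin K → Fin q → ℝ) × (Fin r → ℝ),
        ∑ i, ∑ j, Y i j * Real.log (bppoPi m K q r a b p.1 p.2 i j)) := by
  obtain ⟨ρ, hρ⟩ := bppo_aux_perm K σ h
  have key : ∀ (β : Fin K → Fin q → ℝ) (ζ : Fin r → ℝ) (i : Fin m) (j : Fin (K + 1)),
      bppoPi m K q r a b (fun l => β (ρ l)) ζ i j = bppoPi m K q r a b β ζ i (σ j) := by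
    intro β ζ i j
    have hs : ∑ l, Real.exp (bppoEta m K q r a b (fun l => β (ρ l)) ζ i l)
        = ∑ l, Real.exp (bppoEta m K q r a b β ζ i l) :=
      Equiv.sum_comp ρ (fun l => Real.exp (bppoEta m K q r a b β ζ i l))
    unfold bppoPi
    rw [hs]
    congr 1
    induction j using Fin.lastCases with
    | last => simp [h]
    | cast j => simp [hρ, bppoEta]
  symm
  refine Equiv.iSup_congr
    ((Equiv.arrowCongr ρ.symm (Equiv.refl (Fin q → ℝ))).prodCongr (Equiv.refl (Fin r → ℝ))) ?_
  rintro ⟨β, ζ⟩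
  refine Finset.sum_congr rfl fun i _ => ?_
  rw [← Equiv.sum_comp σ (fun j => Y i j * Real.log (bppoPi m K q r a b β ζ i j))]
  refine Finset.sum_congr rfl fun j _ => ?_
  rw [← key]
  rfl

/-- In the baseline-category ppo model with common predictor vectors and full
parameter space, any two orders that keep the baseline category `J` invariant attain the same
supremum of the reduced log-likelihood, i.e. they are equivalent. -/
theorem baseline_ppo_orders_equivalent
    (m K q r : ℕ) (hm : 1 ≤ m) (hK : 2 ≤ K)
    (a : Fin m → Fin q → ℝ) (b : Fin m → Fin r → ℝ)
    (Y : Fin m → Fin (K + 1) → ℝ) (hY : ∀ i j, 0 ≤ Y i j)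
    (σ₁ σ₂ : Equiv.Perm (Fin (K + 1)))
    (h₁ : σ₁ (Fin.last K) = Fin.last K) (h₂ : σ₂ (Fin.last K) = Fin.last K) :
    (⨆ p : (Fin K → Fin q → ℝ) × (Fin r → ℝ),
        ∑ i, ∑ j, Y i (σ₁ j) * Real.log (bppoPi m K q r a b p.1 p.2 i j)) =
    (⨆ p : (Fin K → Fin q → ℝ) × (Fin r → ℝ),
        ∑ i, ∑ j, Y i (σ₂ j) * Real.log (bppoPi m K q r a b p.1 p.2 i j)) := by
  rw [bppo_aux_sup m K q r a b Y σ₁ h₁, bppo_aux_sup m K q r a b Y σ₂ h₂]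
end

section
/- Consider the cumulative ppo model with symmetric predictor vectors, i.e. a_{ij} = a_{i,J−j} for all i = 1,…,m and j = 1,…,J−1. For a parameter θ₁ = (β_1,…,β_{J−1}, ζ), define θ₂ = (−β_{J−1}, −β_{J−2},…,−β_1, −ζ). Then θ₁ belongs to the feasible parameter space Θ if and only if θ₂ does, and for θ₁ ∈ Θ, π_{ij}(θ₂) = π_{i,J+1−j}(θ₁) for all i = 1,…,m and all j = 1,…,J. -/
/-- Linear predictor of the cumulative ppo model: `η_{ij}(θ) = ⟪a_{ij}, β_j⟫ + ⟪b_i, ζ⟫`. -/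
noncomputable def cppoEta (m K q r : ℕ) (a : Fin m → Fin K → Fin q → ℝ)
    (b : Fin m → Fin r → ℝ) (β : Fin K → Fin q → ℝ) (ζ : Fin r → ℝ)
    (i : Fin m) (j : Fin K) : ℝ :=
  (∑ x, a i j x * β j x) + ∑ x, b i x * ζ x

/-- `ρ_{ij}(θ) = exp(η_{ij}(θ)) / (1 + exp(η_{ij}(θ)))`. -/
noncomputable def cppoRho (m K q r : ℕ) (a : Fin m → Fin K → Fin q → ℝ)
    (b : Fin m → Fin r → ℝ) (β : Fin K → Fin q → ℝ) (ζ : Fin r → ℝ)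
    (i : Fin m) (j : Fin K) : ℝ :=
  Real.exp (cppoEta m K q r a b β ζ i j) / (1 + Real.exp (cppoEta m K q r a b β ζ i j))

/-- Category probabilities of the cumulative ppo model (`J = K + 1` categories,
`π_{ij} = ρ_{ij} − ρ_{i,j−1}` with `ρ_{i0} = 0`, and `π_{iJ} = 1 − ρ_{i,J−1}`). -/
noncomputable def cppoPi (m K q r : ℕ) (a : Fin m → Fin K → Fin q → ℝ)
    (b : Fin m → Fin r → ℝ) (β : Fin K → Fin q → ℝ) (ζ : Fin r → ℝ)
    (i : Fin m) (c : Fin (K + 1)) : ℝ :=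
  (if h : (c : ℕ) < K then cppoRho m K q r a b β ζ i ⟨c, h⟩ else 1) -
    (if h : 0 < (c : ℕ) then
      cppoRho m K q r a b β ζ i ⟨(c : ℕ) - 1, by have := c.isLt; omega⟩ else 0)

/-- Feasible parameter space of the cumulative ppo model:
`⟪a_{ij}, β_j⟫ < ⟪a_{i,j+1}, β_{j+1}⟫` for all `i` and `j = 1, …, J−2`. -/
def cppoFeasible (m K q : ℕ) (a : Fin m → Fin K → Fin q → ℝ)
    (β : Fin K → Fin q → ℝ) : Prop :=
  ∀ (i : Fin m) (t : Fin (K - 1)),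
    (∑ x, a i ⟨(t : ℕ), by have := t.isLt; omega⟩ x * β ⟨(t : ℕ), by have := t.isLt; omega⟩ x) <
      ∑ x, a i ⟨(t : ℕ) + 1, by have := t.isLt; omega⟩ x *
        β ⟨(t : ℕ) + 1, by have := t.isLt; omega⟩ x

theorem cppo_sum_rev {m K q : ℕ}
    (a : Fin m → Fin K → Fin q → ℝ)
    (hsym : ∀ (i : Fin m) (j : Fin K), a i j = a i j.rev)
    (β β₂ : Fin K → Fin q → ℝ)
    (hβ₂ : ∀ j : Fin K, β₂ j = -(β j.rev)) (i : Fin m) (j l : Fin K)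
    (hl : (j : ℕ) + l + 1 = K) :
    ∑ x, a i j x * β₂ j x = -∑ x, a i l x * β l x := by
  have : j.rev = l := by ext; simp [Fin.val_rev]; omega
  rw [hsym i j, hβ₂ j, this]
  simp

theorem cppo_feas_rev {m K q : ℕ}
    (a : Fin m → Fin K → Fin q → ℝ)
    (hsym : ∀ (i : Fin m) (j : Fin K), a i j = a i j.rev)
    (β β₂ : Fin K → Fin q → ℝ)
    (hβ₂ : ∀ j : Fin K, β₂ j = -(β j.rev)) (h : cppoFeasible m K q a β) :
    cppoFeasible m K q a β₂ := by
  intro i t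
  have ht := t.isLt
  rw [cppo_sum_rev a hsym β β₂ hβ₂ i ⟨t, by omega⟩ ⟨K - 2 - t + 1, by omega⟩
      (by simp only; omega),
    cppo_sum_rev a hsym β β₂ hβ₂ i ⟨t + 1, by omega⟩ ⟨K - 2 - t, by omega⟩
      (by simp only; omega)]
  exact neg_lt_neg (h i ⟨K - 2 - t, by omega⟩)

theorem cppo_rho_rev {m K q r : ℕ}
    (a : Fin m → Fin K → Fin q → ℝ) (b : Fin m → Fin r → ℝ)
    (hsym : ∀ (i : Fin m) (j : Fin K), a i j = a i j.rev)
    (β β₂ : Fin K → Fin q → ℝ) (ζ : Fin r → ℝ)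
    (hβ₂ : ∀ j : Fin K, β₂ j = -(β j.rev)) (i : Fin m) (j l : Fin K)
    (hl : (j : ℕ) + l + 1 = K) :
    cppoRho m K q r a b β₂ (-ζ) i j = 1 - cppoRho m K q r a b β ζ i l := by
  have h : cppoEta m K q r a b β₂ (-ζ) i j = -cppoEta m K q r a b β ζ i l := by
    unfold cppoEta
    rw [cppo_sum_rev a hsym β β₂ hβ₂ i j l hl]
    simp
    ring
  unfold cppoRho
  rw [h, Real.exp_neg]
  have := Real.exp_pos (cppoEta m K q r a b β ζ i l)
  field_simp
  ring

/-- In the cumulative ppo model with symmetric predictor vectors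
(`a_{ij} = a_{i,J−j}`, i.e. `a i j = a i j.rev`), the parameter
`θ₂ = (−β_{J−1}, …, −β_1, −ζ)` is feasible iff `θ₁ = (β_1, …, β_{J−1}, ζ)` is, and for
feasible `θ₁`, `π_{ij}(θ₂) = π_{i,J+1−j}(θ₁)` for all `i, j` (reversal `J+1−j` is `Fin.rev`). -/
theorem cumulative_ppo_reverse_prob
    (m K q r : ℕ) (hm : 1 ≤ m) (hK : 2 ≤ K)
    (a : Fin m → Fin K → Fin q → ℝ) (b : Fin m → Fin r → ℝ)
    (hsym : ∀ (i : Fin m) (j : Fin K), a i j = a i j.rev)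
    (β : Fin K → Fin q → ℝ) (ζ : Fin r → ℝ)
    (β₂ : Fin K → Fin q → ℝ) (ζ₂ : Fin r → ℝ)
    (hβ₂ : ∀ j : Fin K, β₂ j = -(β j.rev)) (hζ₂ : ζ₂ = -ζ) :
    (cppoFeasible m K q a β ↔ cppoFeasible m K q a β₂) ∧
      (cppoFeasible m K q a β →
        ∀ (i : Fin m) (c : Fin (K + 1)),
          cppoPi m K q r a b β₂ ζ₂ i c = cppoPi m K q r a b β ζ i c.rev) := by
  subst hζ₂
  refine ⟨⟨cppo_feas_rev a hsym β β₂ hβ₂, cppo_feas_rev a hsym β₂ β ?_⟩, ?_⟩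
  · intro j
    simp [hβ₂]
  intro _ i c
  have hc := c.isLt
  have hr : (c.rev : ℕ) = K - c := by simp [Fin.val_rev]
  have e1 : (if h : (c : ℕ) < K then cppoRho m K q r a b β₂ (-ζ) i ⟨c, h⟩ else 1) =
      1 - (if h : 0 < (c.rev : ℕ) then
        cppoRho m K q r a b β ζ i ⟨(c.rev : ℕ) - 1, by omega⟩ else 0) := by
    by_cases h : (c : ℕ) < K
    · rw [dif_pos h, dif_pos (by omega)]
      exact cppo_rho_rev a b hsym β β₂ ζ hβ₂ i _ _ (by simp only; omega)
    · rw [dif_neg h, dif_neg (by omega)]; ring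
  have e2 : (if h : 0 < (c : ℕ) then
        cppoRho m K q r a b β₂ (-ζ) i ⟨(c : ℕ) - 1, by omega⟩ else 0) =
      1 - (if h : (c.rev : ℕ) < K then cppoRho m K q r a b β ζ i ⟨c.rev, h⟩ else 1) := by
    by_cases h : 0 < (c : ℕ)
    · rw [dif_pos h, dif_pos (by omega)]
      exact cppo_rho_rev a b hsym β β₂ ζ hβ₂ i _ _ (by simp only; omega)
    · rw [dif_neg h, dif_neg (by omega)]; ring
  unfold cppoPi
  rw [e1, e2]
  ring
end

section
/- Consider the adjacent-categories ppo model with common predictor vectors. For a parameter θ₁ = (β_1,…,β_{J−1}, ζ), define θ₂ = (−β_{J−1}, −β_{J−2},…,−β_1, −ζ). Then π_{ij}(θ₂) = π_{i,J+1−j}(θ₁) for all i = 1,…,m and all j = 1,…,J. -/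
/-- Linear predictor of the adjacent-categories ppo model with common predictor vectors:
`η_{ij}(θ) = ⟪a_i, β_j⟫ + ⟪b_i, ζ⟫`. -/
noncomputable def appoEta (m K q r : ℕ) (a : Fin m → Fin q → ℝ) (b : Fin m → Fin r → ℝ)
    (β : Fin K → Fin q → ℝ) (ζ : Fin r → ℝ) (i : Fin m) (j : Fin K) : ℝ :=
  (∑ x, a i x * β j x) + ∑ x, b i x * ζ x

/-- Category probabilities of the adjacent-categories ppo model (`J = K + 1` categories;
for `j = 1, …, J−1`, `π_{ij} = exp(Σ_{l=j}^{J−1} η_{il}) / (1 + Σ_s exp(Σ_{l=s}^{J−1} η_{il}))`,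
and `π_{iJ}` has numerator `1`). -/
noncomputable def appoPi (m K q r : ℕ) (a : Fin m → Fin q → ℝ) (b : Fin m → Fin r → ℝ)
    (β : Fin K → Fin q → ℝ) (ζ : Fin r → ℝ) (i : Fin m) (c : Fin (K + 1)) : ℝ :=
  (if (c : ℕ) < K then
      Real.exp (∑ l ∈ Finset.univ.filter (fun l : Fin K => (c : ℕ) ≤ (l : ℕ)),
        appoEta m K q r a b β ζ i l)
    else 1) /
    (1 + ∑ s : Fin K,
      Real.exp (∑ l ∈ Finset.univ.filter (fun l : Fin K => s ≤ l),
        appoEta m K q r a b β ζ i l))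

noncomputable def appoT (K : ℕ) (e : Fin K → ℝ) (n : ℕ) : ℝ :=
  ∑ l ∈ Finset.univ.filter (fun l : Fin K => n ≤ (l : ℕ)), e l

theorem appoT_last (K : ℕ) (e : Fin K → ℝ) (n : ℕ) (h : ¬ n < K) : appoT K e n = 0 := by
  unfold appoT
  apply Finset.sum_eq_zero
  intro l hl
  have := (Finset.mem_filter.mp hl).2
  have := l.isLt
  omega

theorem appoT_rev (K : ℕ) (e e₂ : Fin K → ℝ) (h : ∀ l, e₂ l = - e l.rev) (c : Fin (K + 1)) :
    appoT K e₂ c = appoT K e c.rev - appoT K e 0 := by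
  unfold appoT
  simp only [Finset.sum_filter]
  rw [← Equiv.sum_comp Fin.revPerm, ← Finset.sum_sub_distrib]
  apply Finset.sum_congr rfl
  intro l _
  have h1 := l.isLt
  have h2 := c.isLt
  simp only [Fin.revPerm_apply, h, Fin.rev_rev, Fin.val_rev]
  by_cases h3 : (c : ℕ) ≤ K - (l + 1)
  · rw [if_pos h3, if_neg (by omega), if_pos (by omega)]; ring
  · rw [if_neg h3, if_pos (by omega), if_pos (by omega)]; ring

theorem appoPi_eq (m K q r : ℕ) (a : Fin m → Fin q → ℝ) (b : Fin m → Fin r → ℝ)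
    (β : Fin K → Fin q → ℝ) (ζ : Fin r → ℝ) (i : Fin m) (c : Fin (K + 1)) :
    appoPi m K q r a b β ζ i c =
      Real.exp (appoT K (appoEta m K q r a b β ζ i) c) /
        ∑ s : Fin (K + 1), Real.exp (appoT K (appoEta m K q r a b β ζ i) s) := by
  unfold appoPi
  congr 1
  · split_ifs with h
    · rfl
    · rw [appoT_last _ _ _ h, Real.exp_zero]
  · rw [Fin.sum_univ_castSucc, add_comm, appoT_last K _ (Fin.last K : ℕ) (by simp), Real.exp_zero]
    rfl

/-- In the adjacent-categories ppo model with common predictor vectors, the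
parameter `θ₂ = (−β_{J−1}, …, −β_1, −ζ)` satisfies `π_{ij}(θ₂) = π_{i,J+1−j}(θ₁)` for all
`i, j` (the reversal `j ↦ J+1−j` is `Fin.rev` on `Fin (K+1)`). -/
theorem adjacent_ppo_reverse_prob
    (m K q r : ℕ) (hm : 1 ≤ m) (hK : 2 ≤ K)
    (a : Fin m → Fin q → ℝ) (b : Fin m → Fin r → ℝ)
    (β : Fin K → Fin q → ℝ) (ζ : Fin r → ℝ)
    (β₂ : Fin K → Fin q → ℝ) (ζ₂ : Fin r → ℝ)
    (hβ₂ : ∀ j : Fin K, β₂ j = -(β j.rev)) (hζ₂ : ζ₂ = -ζ) :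
    ∀ (i : Fin m) (c : Fin (K + 1)),
      appoPi m K q r a b β₂ ζ₂ i c = appoPi m K q r a b β ζ i c.rev := by
  intro i c
  have he : ∀ l, appoEta m K q r a b β₂ ζ₂ i l = - appoEta m K q r a b β ζ i l.rev := by
    intro l
    simp only [appoEta, hβ₂, hζ₂, Pi.neg_apply, mul_neg, Finset.sum_neg_distrib]
    ring
  rw [appoPi_eq, appoPi_eq]
  simp only [appoT_rev K _ _ he, Real.exp_sub]
  rw [← Finset.sum_div, div_div_div_cancel_right₀ (Real.exp_ne_zero _)]
  congr 1
  exact Equiv.sum_comp Fin.revPerm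
    (fun s : Fin (K + 1) => Real.exp (appoT K (appoEta m K q r a b β ζ i) s))
end

section
/- Consider the adjacent-categories ppo model with common predictor vectors, with parameter space Θ = (ℝ^q)^{J−1} × ℝ^r (all parameter tuples). Let Y : Fin m → Fin J → ℝ be nonnegative counts. Then any order σ₁ (a permutation of {1,…,J}) is equivalent to its reverse order σ₂ defined by σ₂(j) = σ₁(J+1−j) for j = 1,…,J; that is, ⨆_{θ∈Θ} l_{σ₁}(θ) = ⨆_{θ∈Θ} l_{σ₂}(θ). -/
theorem appoPi_eq_aux (m K q r : ℕ) (a : Fin m → Fin q → ℝ) (b : Fin m → Fin r → ℝ)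
    (β : Fin K → Fin q → ℝ) (ζ : Fin r → ℝ) (i : Fin m) (c : Fin (K + 1)) :
    appoPi m K q r a b β ζ i c =
      Real.exp (∑ l ∈ Finset.univ.filter (fun l : Fin K => (c : ℕ) ≤ (l : ℕ)),
        appoEta m K q r a b β ζ i l) /
      ∑ s : Fin (K + 1), Real.exp (∑ l ∈ Finset.univ.filter (fun l : Fin K => (s : ℕ) ≤ (l : ℕ)),
        appoEta m K q r a b β ζ i l) := by
  have hlast : ∀ c : Fin (K + 1), ¬ (c : ℕ) < K →
      Finset.univ.filter (fun l : Fin K => (c : ℕ) ≤ (l : ℕ)) = ∅ := by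
    intro c hc
    ext l
    have := l.2
    simp
    omega
  unfold appoPi
  congr 1
  · split_ifs with h
    · rfl
    · rw [hlast c h]; simp
  · rw [Fin.sum_univ_castSucc, hlast (Fin.last K) (by simp), add_comm]
    simp only [Finset.sum_empty, Real.exp_zero, Fin.val_castSucc, Fin.le_def]

theorem appoEta_neg_aux (m K q r : ℕ) (a : Fin m → Fin q → ℝ) (b : Fin m → Fin r → ℝ)
    (β : Fin K → Fin q → ℝ) (ζ : Fin r → ℝ) (i : Fin m) (j : Fin K) :
    appoEta m K q r a b (fun j => -β j.rev) (-ζ) i j = -appoEta m K q r a b β ζ i j.rev := by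
  simp [appoEta, Finset.sum_neg_distrib]
  ring

theorem appo_sum_aux (K : ℕ) (f : Fin K → ℝ) (c : Fin (K + 1)) :
    ∑ l ∈ Finset.univ.filter (fun l : Fin K => (c.rev : ℕ) ≤ (l : ℕ)), -f l.rev =
    ∑ l ∈ Finset.univ.filter (fun l : Fin K => (c : ℕ) ≤ (l : ℕ)), f l - ∑ l, f l := by
  have h1 : ∑ l ∈ Finset.univ.filter (fun l : Fin K => (c.rev : ℕ) ≤ (l : ℕ)), -f l.rev =
      - ∑ l ∈ Finset.univ.filter (fun l : Fin K => ¬ (c : ℕ) ≤ (l : ℕ)), f l := by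
    rw [← Finset.sum_neg_distrib, Finset.sum_filter, Finset.sum_filter,
      ← Equiv.sum_comp Fin.revPerm]
    refine Finset.sum_congr rfl fun l _ => ?_
    have := l.2
    have := c.2
    have e : ((c.rev : ℕ) ≤ (l.rev : ℕ)) ↔ ¬ (c : ℕ) ≤ (l : ℕ) := by
      simp only [Fin.val_rev]; omega
    simp only [Fin.revPerm_apply, Fin.rev_rev, e]
  rw [h1, ← Finset.sum_filter_add_sum_filter_not Finset.univ
    (fun l : Fin K => (c : ℕ) ≤ (l : ℕ)) f]
  ring

theorem appoPi_rev_aux (m K q r : ℕ) (a : Fin m → Fin q → ℝ) (b : Fin m → Fin r → ℝ)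
    (β : Fin K → Fin q → ℝ) (ζ : Fin r → ℝ) (i : Fin m) (c : Fin (K + 1)) :
    appoPi m K q r a b (fun j => -β j.rev) (-ζ) i c.rev = appoPi m K q r a b β ζ i c := by
  rw [appoPi_eq_aux, appoPi_eq_aux, ← Equiv.sum_comp Fin.revPerm]
  simp only [appoEta_neg_aux, Fin.revPerm_apply, appo_sum_aux, Real.exp_sub]
  rw [← Finset.sum_div, div_div_div_cancel_right₀ (Real.exp_ne_zero _)]

/-- In the adjacent-categories ppo model with common predictor vectors and full
parameter space, any order `σ₁` is equivalent to its reverse order `σ₂` (`σ₂ j = σ₁ j.rev`):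
the suprema of the reduced log-likelihood coincide. -/
theorem adjacent_ppo_reverse_order_equivalent
    (m K q r : ℕ) (hm : 1 ≤ m) (hK : 2 ≤ K)
    (a : Fin m → Fin q → ℝ) (b : Fin m → Fin r → ℝ)
    (Y : Fin m → Fin (K + 1) → ℝ) (hY : ∀ i j, 0 ≤ Y i j)
    (σ₁ σ₂ : Equiv.Perm (Fin (K + 1)))
    (hσ₂ : ∀ j : Fin (K + 1), σ₂ j = σ₁ j.rev) :
    (⨆ p : (Fin K → Fin q → ℝ) × (Fin r → ℝ),
        ∑ i, ∑ j, Y i (σ₁ j) * Real.log (appoPi m K q r a b p.1 p.2 i j)) =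
    (⨆ p : (Fin K → Fin q → ℝ) × (Fin r → ℝ),
        ∑ i, ∑ j, Y i (σ₂ j) * Real.log (appoPi m K q r a b p.1 p.2 i j)) := by
  let e : (Fin K → Fin q → ℝ) × (Fin r → ℝ) ≃ (Fin K → Fin q → ℝ) × (Fin r → ℝ) :=
    { toFun := fun p => (fun j => -p.1 j.rev, -p.2)
      invFun := fun p => (fun j => -p.1 j.rev, -p.2)
      left_inv := fun p => by simp
      right_inv := fun p => by simp }
  refine Equiv.iSup_congr e fun p => ?_
  refine Finset.sum_congr rfl fun i _ => ?_
  rw [← Equiv.sum_comp Fin.revPerm]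
  refine Finset.sum_congr rfl fun j _ => ?_
  simp only [Fin.revPerm_apply, hσ₂, Fin.rev_rev, e, Equiv.coe_fn_mk, appoPi_rev_aux]
end

section
/- Consider the baseline-category npo model with common predictor vectors, with parameter space Θ = (ℝ^q)^{J−1} (all parameter tuples). Let Y : Fin m → Fin J → ℝ be nonnegative counts. Then all orders of the response categories are equivalent: for any two permutations σ₁, σ₂ of {1,…,J}, ⨆_{θ∈Θ} l_{σ₁}(θ) = ⨆_{θ∈Θ} l_{σ₂}(θ). -/
/-- Category probabilities of the baseline-category npo model with common predictor vectors
(`J = K + 1` categories). -/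
noncomputable def bnpoPi (m K q : ℕ) (a : Fin m → Fin q → ℝ)
    (β : Fin K → Fin q → ℝ) (i : Fin m) (c : Fin (K + 1)) : ℝ :=
  (if h : (c : ℕ) < K then Real.exp (∑ x, a i x * β ⟨c, h⟩ x) else 1) /
    (1 + ∑ l : Fin K, Real.exp (∑ x, a i x * β l x))

/-- Extend the parameter by zero at the baseline category. -/
noncomputable def bnpoExt (K q : ℕ) (β : Fin K → Fin q → ℝ) (c : Fin (K + 1)) : Fin q → ℝ :=
  if h : (c : ℕ) < K then β ⟨c, h⟩ else 0

theorem bnpoPi_eq (m K q : ℕ) (a : Fin m → Fin q → ℝ)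
    (β : Fin K → Fin q → ℝ) (i : Fin m) (c : Fin (K + 1)) :
    bnpoPi m K q a β i c = Real.exp (∑ x, a i x * bnpoExt K q β c x) /
      ∑ l, Real.exp (∑ x, a i x * bnpoExt K q β l x) := by
  unfold bnpoPi
  congr 1
  · by_cases h : (c : ℕ) < K <;> simp [bnpoExt, h]
  · rw [Fin.sum_univ_castSucc, add_comm]
    simp [bnpoExt]

theorem bnpo_perm (m K q : ℕ) (a : Fin m → Fin q → ℝ)
    (β : Fin K → Fin q → ℝ) (τ : Equiv.Perm (Fin (K + 1))) :
    ∃ β' : Fin K → Fin q → ℝ, ∀ i c, bnpoPi m K q a β' i c = bnpoPi m K q a β i (τ c) := by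
  refine ⟨fun l => bnpoExt K q β (τ l.castSucc) - bnpoExt K q β (τ (Fin.last K)), ?_⟩
  intro i c
  have key : ∀ c, bnpoExt K q (fun l => bnpoExt K q β (τ l.castSucc)
      - bnpoExt K q β (τ (Fin.last K))) c
      = bnpoExt K q β (τ c) - bnpoExt K q β (τ (Fin.last K)) := by
    intro c
    induction c using Fin.lastCases with
    | last => conv_lhs => unfold bnpoExt
              simp
    | cast l => conv_lhs => unfold bnpoExt
                simp [bnpoExt]
  rw [bnpoPi_eq, bnpoPi_eq]
  simp only [key, Pi.sub_apply, mul_sub, Finset.sum_sub_distrib, Real.exp_sub]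
  rw [← Finset.sum_div, div_div_div_cancel_right₀ (Real.exp_ne_zero _),
    Equiv.sum_comp τ (fun l => Real.exp (∑ x, a i x * bnpoExt K q β l x))]

theorem bnpo_range (m K q : ℕ) (a : Fin m → Fin q → ℝ)
    (Y : Fin m → Fin (K + 1) → ℝ) (σ₁ σ₂ : Equiv.Perm (Fin (K + 1))) :
    Set.range (fun β : Fin K → Fin q → ℝ =>
        ∑ i, ∑ j, Y i (σ₂ j) * Real.log (bnpoPi m K q a β i j)) ⊆
    Set.range (fun β : Fin K → Fin q → ℝ =>
        ∑ i, ∑ j, Y i (σ₁ j) * Real.log (bnpoPi m K q a β i j)) := by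
  rintro _ ⟨β, rfl⟩
  obtain ⟨β', h⟩ := bnpo_perm m K q a β (σ₂⁻¹ * σ₁)
  refine ⟨β', ?_⟩
  refine Finset.sum_congr rfl fun i _ => ?_
  rw [← Equiv.sum_comp (σ₂⁻¹ * σ₁)
    (fun j => Y i (σ₂ j) * Real.log (bnpoPi m K q a β i j))]
  refine Finset.sum_congr rfl fun j _ => ?_
  rw [h]
  simp

/-- In the baseline-category npo model with common predictor vectors and full
parameter space, all orders of the response categories are equivalent: any two permutations
attain the same supremum of the reduced log-likelihood. -/
theorem baseline_npo_all_orders_equivalent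
    (m K q : ℕ) (hm : 1 ≤ m) (hK : 2 ≤ K)
    (a : Fin m → Fin q → ℝ)
    (Y : Fin m → Fin (K + 1) → ℝ) (hY : ∀ i j, 0 ≤ Y i j)
    (σ₁ σ₂ : Equiv.Perm (Fin (K + 1))) :
    (⨆ β : Fin K → Fin q → ℝ,
        ∑ i, ∑ j, Y i (σ₁ j) * Real.log (bnpoPi m K q a β i j)) =
    (⨆ β : Fin K → Fin q → ℝ,
        ∑ i, ∑ j, Y i (σ₂ j) * Real.log (bnpoPi m K q a β i j)) := by
  exact congrArg sSup (Set.Subset.antisymm (bnpo_range m K q a Y σ₂ σ₁)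
    (bnpo_range m K q a Y σ₁ σ₂))
end

section
/- Consider the adjacent-categories npo model with common predictor vectors. Let σ be an arbitrary permutation of {1,…,J}. For a parameter θ₁ = (β_1,…,β_{J−1}), define θ₂ = (β'_1,…,β'_{J−1}) by β'_j = Σ_{l=σ(j)}^{σ(j+1)−1} β_l if σ(j) < σ(j+1), and β'_j = −Σ_{l=σ(j+1)}^{σ(j)−1} β_l if σ(j) > σ(j+1), for j = 1,…,J−1. Then π_{ij}(θ₂) = π_{i,σ(j)}(θ₁) for all i = 1,…,m and all j = 1,…,J. -/
/-- Linear predictor of the adjacent-categories npo model with common predictor vectors. -/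
noncomputable def anpoEta (m K q : ℕ) (a : Fin m → Fin q → ℝ)
    (β : Fin K → Fin q → ℝ) (i : Fin m) (j : Fin K) : ℝ :=
  ∑ x, a i x * β j x

/-- Category probabilities of the adjacent-categories npo model (`J = K + 1` categories). -/
noncomputable def anpoPi (m K q : ℕ) (a : Fin m → Fin q → ℝ)
    (β : Fin K → Fin q → ℝ) (i : Fin m) (c : Fin (K + 1)) : ℝ :=
  (if (c : ℕ) < K then
      Real.exp (∑ l ∈ Finset.univ.filter (fun l : Fin K => (c : ℕ) ≤ (l : ℕ)),
        anpoEta m K q a β i l)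
    else 1) /
    (1 + ∑ s : Fin K,
      Real.exp (∑ l ∈ Finset.univ.filter (fun l : Fin K => s ≤ l), anpoEta m K q a β i l))

/-- Tail sums. -/
noncomputable def tailSum (K : ℕ) (f : Fin K → ℝ) (c : Fin (K + 1)) : ℝ :=
  ∑ l : Fin K, if (c : ℕ) ≤ (l : ℕ) then f l else 0

theorem tailSum_last (K : ℕ) (f : Fin K → ℝ) : tailSum K f (Fin.last K) = 0 := by
  unfold tailSum
  apply Finset.sum_eq_zero
  intro l _
  have := l.isLt
  rw [if_neg]
  simp

theorem tailSum_castSucc (K : ℕ) (f : Fin K → ℝ) (t : Fin K) :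
    tailSum K f t.castSucc = f t + tailSum K f t.succ := by
  unfold tailSum
  have h : f t = ∑ l : Fin K, if l = t then f l else 0 := by simp
  rw [h, ← Finset.sum_add_distrib]
  apply Finset.sum_congr rfl
  intro l _
  simp only [Fin.val_castSucc, Fin.val_succ, Fin.ext_iff]
  split_ifs <;> first | omega | simp

theorem tailSum_sub (K : ℕ) (f : Fin K → ℝ) (c d : Fin (K + 1)) (h : (c : ℕ) ≤ d) :
    ∑ l ∈ Finset.univ.filter (fun l : Fin K => (c : ℕ) ≤ (l : ℕ) ∧ (l : ℕ) < (d : ℕ)), f l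
      = tailSum K f c - tailSum K f d := by
  unfold tailSum
  rw [Finset.sum_filter, ← Finset.sum_sub_distrib]
  apply Finset.sum_congr rfl
  intro l _
  split_ifs <;> first | omega | simp

theorem anpoPi_eq (m K q : ℕ) (a : Fin m → Fin q → ℝ)
    (β : Fin K → Fin q → ℝ) (i : Fin m) (c : Fin (K + 1)) :
    anpoPi m K q a β i c = Real.exp (tailSum K (anpoEta m K q a β i) c) /
      ∑ s, Real.exp (tailSum K (anpoEta m K q a β i) s) := by
  unfold anpoPi
  congr 1
  · split_ifs with h
    · rw [Finset.sum_filter]; rfl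
    · have : c = Fin.last K := by
        apply Fin.ext
        have := c.isLt
        simp only [Fin.val_last]
        omega
      rw [this, tailSum_last, Real.exp_zero]
  · rw [Fin.sum_univ_castSucc, tailSum_last, Real.exp_zero, add_comm]
    congr 1
    apply Finset.sum_congr rfl
    intro s _
    rw [Finset.sum_filter]; rfl

theorem anpoEta_sum (m K q : ℕ) (a : Fin m → Fin q → ℝ)
    (β : Fin K → Fin q → ℝ) (i : Fin m) (S : Finset (Fin K)) :
    ∑ x, a i x * (∑ l ∈ S, β l) x = ∑ l ∈ S, anpoEta m K q a β i l := by
  unfold anpoEta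
  rw [Finset.sum_comm]
  simp only [Finset.sum_apply, Finset.mul_sum]

/-- In the adjacent-categories npo model with common predictor vectors, for an
arbitrary permutation `σ` of the categories, the parameter `θ₂` with
`β'_j = Σ_{l=σ(j)}^{σ(j+1)−1} β_l` if `σ(j) < σ(j+1)` and
`β'_j = −Σ_{l=σ(j+1)}^{σ(j)−1} β_l` if `σ(j) > σ(j+1)` satisfies
`π_{ij}(θ₂) = π_{i,σ(j)}(θ₁)` for all `i, j`.  (Categories `j` and `j+1` are encoded as
`t.castSucc` and `t.succ` for `t : Fin K`; the 1-based summation range `σ(j) ≤ l ≤ σ(j+1)−1`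
becomes the 0-based range `σ(t.castSucc) ≤ l < σ(t.succ)` over `l : Fin K`.) -/
theorem adjacent_npo_perm_prob
    (m K q : ℕ) (hm : 1 ≤ m) (hK : 2 ≤ K)
    (a : Fin m → Fin q → ℝ)
    (σ : Equiv.Perm (Fin (K + 1)))
    (β : Fin K → Fin q → ℝ)
    (β₂ : Fin K → Fin q → ℝ)
    (hβ₂ : ∀ t : Fin K, β₂ t =
      if ((σ t.castSucc : Fin (K + 1)) : ℕ) < ((σ t.succ : Fin (K + 1)) : ℕ) then
        ∑ l ∈ Finset.univ.filter (fun l : Fin K =>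
          ((σ t.castSucc : Fin (K + 1)) : ℕ) ≤ (l : ℕ) ∧
            (l : ℕ) < ((σ t.succ : Fin (K + 1)) : ℕ)), β l
      else
        -∑ l ∈ Finset.univ.filter (fun l : Fin K =>
          ((σ t.succ : Fin (K + 1)) : ℕ) ≤ (l : ℕ) ∧
            (l : ℕ) < ((σ t.castSucc : Fin (K + 1)) : ℕ)), β l) :
    ∀ (i : Fin m) (c : Fin (K + 1)),
      anpoPi m K q a β₂ i c = anpoPi m K q a β i (σ c) := by
  intro i c
  have hη : ∀ t : Fin K, anpoEta m K q a β₂ i t =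
      tailSum K (anpoEta m K q a β i) (σ t.castSucc)
        - tailSum K (anpoEta m K q a β i) (σ t.succ) := by
    intro t
    have h0 : anpoEta m K q a β₂ i t = ∑ x, a i x * β₂ t x := rfl
    rw [h0, hβ₂ t]
    split_ifs with h
    · rw [anpoEta_sum, tailSum_sub _ _ _ _ h.le]
    · simp only [Pi.neg_apply, mul_neg, Finset.sum_neg_distrib]
      rw [anpoEta_sum, tailSum_sub _ _ _ _ (not_lt.mp h)]
      ring
  have hT : ∀ c : Fin (K + 1), tailSum K (anpoEta m K q a β₂ i) c =
      tailSum K (anpoEta m K q a β i) (σ c)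
        - tailSum K (anpoEta m K q a β i) (σ (Fin.last K)) := by
    intro c
    induction c using Fin.reverseInduction with
    | last => rw [tailSum_last, sub_self]
    | cast t ih => rw [tailSum_castSucc, ih, hη]; ring
  rw [anpoPi_eq, anpoPi_eq]
  simp only [hT, Real.exp_sub]
  rw [← Finset.sum_div,
    Equiv.sum_comp σ (fun s => Real.exp (tailSum K (anpoEta m K q a β i) s)),
    div_div_div_cancel_right₀ (Real.exp_ne_zero _)]
end

section
/- Consider the continuation-ratio npo model. For a parameter θ₁ = (β_1,…,β_{J−2}, β_{J−1}), define θ₂ = (β_1,…,β_{J−2}, −β_{J−1}). Then for all i = 1,…,m: π_{ij}(θ₂) = π_{ij}(θ₁) for j = 1,…,J−2, π_{i,J−1}(θ₂) = π_{iJ}(θ₁), and π_{iJ}(θ₂) = π_{i,J−1}(θ₁). -/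
/-- Linear predictor of the continuation-ratio npo model: `η_{ij}(θ) = ⟪a_{ij}, β_j⟫`,
where `β_j ∈ ℝ^{q_j}` may have a different dimension for each `j`. -/
noncomputable def crEta (m K : ℕ) (q : Fin K → ℕ)
    (a : (j : Fin K) → Fin m → Fin (q j) → ℝ)
    (β : (j : Fin K) → Fin (q j) → ℝ) (i : Fin m) (j : Fin K) : ℝ :=
  ∑ x, a j i x * β j x

/-- `ρ_{ij}(θ) = exp(η_{ij}(θ)) / (1 + exp(η_{ij}(θ)))`. -/
noncomputable def crRho (m K : ℕ) (q : Fin K → ℕ)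
    (a : (j : Fin K) → Fin m → Fin (q j) → ℝ)
    (β : (j : Fin K) → Fin (q j) → ℝ) (i : Fin m) (j : Fin K) : ℝ :=
  Real.exp (crEta m K q a β i j) / (1 + Real.exp (crEta m K q a β i j))

/-- Category probabilities of the continuation-ratio npo model (`J = K + 1` categories;
`π_{ij} = ρ_{ij} · Π_{l<j} (1 − ρ_{il})` for `j = 1, …, J−1` and
`π_{iJ} = Π_{l=1}^{J−1} (1 − ρ_{il})`). -/
noncomputable def crPi (m K : ℕ) (q : Fin K → ℕ)
    (a : (j : Fin K) → Fin m → Fin (q j) → ℝ)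
    (β : (j : Fin K) → Fin (q j) → ℝ) (i : Fin m) (c : Fin (K + 1)) : ℝ :=
  (if h : (c : ℕ) < K then crRho m K q a β i ⟨c, h⟩ else 1) *
    ∏ l ∈ Finset.univ.filter (fun l : Fin K => (l : ℕ) < (c : ℕ)),
      (1 - crRho m K q a β i l)

/-- In the continuation-ratio npo model, the parameter
`θ₂ = (β_1, …, β_{J−2}, −β_{J−1})` satisfies, for every `i`: `π_{ij}(θ₂) = π_{ij}(θ₁)` for
`j = 1, …, J−2`, `π_{i,J−1}(θ₂) = π_{iJ}(θ₁)`, and `π_{iJ}(θ₂) = π_{i,J−1}(θ₁)`.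
(Category `J−1` has 0-based index `K−1` and category `J` is `Fin.last K`.) -/
theorem continuation_npo_swap_last_two_prob
    (m K : ℕ) (hm : 1 ≤ m) (hK : 2 ≤ K)
    (q : Fin K → ℕ)
    (a : (j : Fin K) → Fin m → Fin (q j) → ℝ)
    (β β₂ : (j : Fin K) → Fin (q j) → ℝ)
    (hβ₂ : ∀ j : Fin K, β₂ j = if (j : ℕ) = K - 1 then -(β j) else β j) :
    ∀ i : Fin m,
      (∀ c : Fin (K + 1), (c : ℕ) < K - 1 →
        crPi m K q a β₂ i c = crPi m K q a β i c) ∧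
      crPi m K q a β₂ i ⟨K - 1, by omega⟩ = crPi m K q a β i (Fin.last K) ∧
      crPi m K q a β₂ i (Fin.last K) = crPi m K q a β i ⟨K - 1, by omega⟩ := by
  intro i
  have hlt : ∀ j : Fin K, (j : ℕ) < K - 1 → crRho m K q a β₂ i j = crRho m K q a β i j := by
    intro j hj
    have h : β₂ j = β j := by rw [hβ₂ j, if_neg (by omega)]
    simp only [crRho, crEta, h]
  have hlast : ∀ j : Fin K, (j : ℕ) = K - 1 →
      crRho m K q a β₂ i j = 1 - crRho m K q a β i j := by
    intro j hj
    have h : β₂ j = -(β j) := by rw [hβ₂ j, if_pos hj]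
    have he : crEta m K q a β₂ i j = - crEta m K q a β i j := by
      simp [crEta, h]
    simp only [crRho, he, Real.exp_neg]
    have := Real.exp_pos (crEta m K q a β i j)
    field_simp
    ring
  have hprod : ∀ n : ℕ, n ≤ K - 1 →
      ∏ l ∈ Finset.univ.filter (fun l : Fin K => (l : ℕ) < n), (1 - crRho m K q a β₂ i l) =
      ∏ l ∈ Finset.univ.filter (fun l : Fin K => (l : ℕ) < n), (1 - crRho m K q a β i l) := by
    intro n hn
    refine Finset.prod_congr rfl fun l hl => ?_
    have hl' : (l : ℕ) < n := by simpa using hl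
    rw [hlt l (by omega)]
  have hk : K - 1 < K := by omega
  have hset : Finset.univ.filter (fun l : Fin K => (l : ℕ) < K) =
      insert (⟨K - 1, hk⟩ : Fin K) (Finset.univ.filter (fun l : Fin K => (l : ℕ) < K - 1)) := by
    ext l
    simp only [Finset.mem_filter, Finset.mem_univ, true_and, Finset.mem_insert, Fin.ext_iff]
    omega
  have hins : ∀ f : Fin K → ℝ,
      ∏ l ∈ Finset.univ.filter (fun l : Fin K => (l : ℕ) < K), f l =
      f ⟨K - 1, hk⟩ * ∏ l ∈ Finset.univ.filter (fun l : Fin K => (l : ℕ) < K - 1), f l := by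
    intro f
    rw [hset, Finset.prod_insert (by simp)]
  refine ⟨fun c hc => ?_, ?_, ?_⟩
  · have hc' : (c : ℕ) < K := by omega
    simp only [crPi, dif_pos hc']
    rw [hprod _ hc.le, hlt ⟨c, hc'⟩ hc]
  · simp only [crPi, Fin.val_last, lt_irrefl, dif_pos hk, dite_false, one_mul]
    rw [hins, hprod _ le_rfl, hlast ⟨K - 1, hk⟩ rfl]
  · simp only [crPi, Fin.val_last, lt_irrefl, dif_pos hk, dite_false, one_mul]
    rw [hins, hprod _ le_rfl, hlast ⟨K - 1, hk⟩ rfl, sub_sub_cancel]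
end

section
/- Consider the continuation-ratio npo model with parameter space Θ = ℝ^{q_1} × … × ℝ^{q_{J−1}} (all parameter tuples). Let Y : Fin m → Fin J → ℝ be nonnegative counts, let σ₁ be any permutation of {1,…,J}, and let τ be the transposition that switches J−1 and J. Then σ₁ is equivalent to σ₂ = σ₁∘τ: ⨆_{θ∈Θ} l_{σ₁}(θ) = ⨆_{θ∈Θ} l_{σ₂}(θ). -/
/-- Negate the last block of parameters. -/
def crFlip (K : ℕ) (q : Fin K → ℕ) (β : (j : Fin K) → Fin (q j) → ℝ) :
    (j : Fin K) → Fin (q j) → ℝ :=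
  fun j x => if (j : ℕ) = K - 1 then - β j x else β j x

theorem crFlip_flip (K : ℕ) (q : Fin K → ℕ) (β : (j : Fin K) → Fin (q j) → ℝ) :
    crFlip K q (crFlip K q β) = β := by
  funext j x
  unfold crFlip
  split_ifs <;> simp

theorem crRho_flip_ne (m K : ℕ) (q : Fin K → ℕ)
    (a : (j : Fin K) → Fin m → Fin (q j) → ℝ)
    (β : (j : Fin K) → Fin (q j) → ℝ) (i : Fin m) (j : Fin K) (hj : (j : ℕ) ≠ K - 1) :
    crRho m K q a (crFlip K q β) i j = crRho m K q a β i j := by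
  simp [crRho, crEta, crFlip, hj]

theorem crRho_flip_eq (m K : ℕ) (q : Fin K → ℕ)
    (a : (j : Fin K) → Fin m → Fin (q j) → ℝ)
    (β : (j : Fin K) → Fin (q j) → ℝ) (i : Fin m) (j : Fin K) (hj : (j : ℕ) = K - 1) :
    crRho m K q a (crFlip K q β) i j = 1 - crRho m K q a β i j := by
  have h : crEta m K q a (crFlip K q β) i j = - crEta m K q a β i j := by
    simp [crEta, crFlip, hj]
  unfold crRho
  rw [h, Real.exp_neg]
  have := Real.exp_pos (crEta m K q a β i j)
  field_simp
  ring

theorem crProd_flip (m K : ℕ) (q : Fin K → ℕ)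
    (a : (j : Fin K) → Fin m → Fin (q j) → ℝ)
    (β : (j : Fin K) → Fin (q j) → ℝ) (i : Fin m) (c : ℕ) (hc : c ≤ K - 1) :
    ∏ l ∈ Finset.univ.filter (fun l : Fin K => (l : ℕ) < c),
      (1 - crRho m K q a (crFlip K q β) i l) =
    ∏ l ∈ Finset.univ.filter (fun l : Fin K => (l : ℕ) < c), (1 - crRho m K q a β i l) := by
  refine Finset.prod_congr rfl fun l hl => ?_
  have hl := (Finset.mem_filter.1 hl).2
  rw [crRho_flip_ne]
  omega

theorem crPi_last (m K : ℕ) (hK : 2 ≤ K) (q : Fin K → ℕ)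
    (a : (j : Fin K) → Fin m → Fin (q j) → ℝ)
    (β : (j : Fin K) → Fin (q j) → ℝ) (i : Fin m) :
    crPi m K q a β i (Fin.last K) = (1 - crRho m K q a β i ⟨K - 1, by omega⟩) *
      ∏ l ∈ Finset.univ.filter (fun l : Fin K => (l : ℕ) < K - 1), (1 - crRho m K q a β i l) := by
  have h : Finset.univ.filter (fun l : Fin K => (l : ℕ) < K) =
      insert (⟨K - 1, by omega⟩ : Fin K)
        (Finset.univ.filter (fun l : Fin K => (l : ℕ) < K - 1)) := by
    ext l
    simp only [Finset.mem_filter, Finset.mem_univ, true_and, Finset.mem_insert, Fin.ext_iff]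
    omega
  unfold crPi
  simp only [Fin.val_last, lt_irrefl, dite_false, one_mul]
  rw [h, Finset.prod_insert (by simp)]

theorem crPi_pen (m K : ℕ) (hK : 2 ≤ K) (q : Fin K → ℕ)
    (a : (j : Fin K) → Fin m → Fin (q j) → ℝ)
    (β : (j : Fin K) → Fin (q j) → ℝ) (i : Fin m) :
    crPi m K q a β i ⟨K - 1, by omega⟩ = crRho m K q a β i ⟨K - 1, by omega⟩ *
      ∏ l ∈ Finset.univ.filter (fun l : Fin K => (l : ℕ) < K - 1), (1 - crRho m K q a β i l) := by
  unfold crPi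
  rw [dif_pos (show K - 1 < K by omega)]

theorem crPi_flip (m K : ℕ) (hK : 2 ≤ K) (q : Fin K → ℕ)
    (a : (j : Fin K) → Fin m → Fin (q j) → ℝ)
    (β : (j : Fin K) → Fin (q j) → ℝ) (i : Fin m) (c : Fin (K + 1)) :
    crPi m K q a (crFlip K q β) i c =
      crPi m K q a β i (Equiv.swap (⟨K - 1, by omega⟩ : Fin (K + 1)) (Fin.last K) c) := by
  by_cases h1 : c = ⟨K - 1, by omega⟩
  · subst h1
    rw [Equiv.swap_apply_left, crPi_pen m K hK, crPi_last m K hK, crRho_flip_eq _ _ _ _ _ _ _ rfl,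
      crProd_flip _ _ _ _ _ _ _ le_rfl]
  by_cases h2 : c = Fin.last K
  · subst h2
    rw [Equiv.swap_apply_right, crPi_pen m K hK, crPi_last m K hK, crRho_flip_eq _ _ _ _ _ _ _ rfl,
      crProd_flip _ _ _ _ _ _ _ le_rfl, sub_sub_cancel]
  rw [Equiv.swap_apply_of_ne_of_ne h1 h2]
  have h3 : (c : ℕ) < K - 1 := by
    have := c.2
    simp only [Fin.ext_iff, Fin.val_last] at h1 h2
    omega
  unfold crPi
  rw [crProd_flip _ _ _ _ _ _ _ h3.le, dif_pos (by omega), dif_pos (by omega),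
    crRho_flip_ne _ _ _ _ _ _ _ h3.ne]

/-- In the continuation-ratio npo model with full parameter space, any order
`σ₁` is equivalent to `σ₂ = σ₁ ∘ τ`, where `τ` is the transposition switching the last two
categories `J−1` (0-based index `K−1`) and `J` (`Fin.last K`): the suprema of the reduced
log-likelihood coincide. -/
theorem continuation_npo_swap_last_two_equivalent
    (m K : ℕ) (hm : 1 ≤ m) (hK : 2 ≤ K)
    (q : Fin K → ℕ)
    (a : (j : Fin K) → Fin m → Fin (q j) → ℝ)
    (Y : Fin m → Fin (K + 1) → ℝ) (hY : ∀ i j, 0 ≤ Y i j)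
    (σ₁ : Equiv.Perm (Fin (K + 1))) :
    (⨆ β : (j : Fin K) → Fin (q j) → ℝ,
        ∑ i, ∑ j, Y i (σ₁ j) * Real.log (crPi m K q a β i j)) =
    (⨆ β : (j : Fin K) → Fin (q j) → ℝ,
        ∑ i, ∑ j,
          Y i ((σ₁ * Equiv.swap (⟨K - 1, by omega⟩ : Fin (K + 1)) (Fin.last K)) j) *
            Real.log (crPi m K q a β i j)) := by
  refine Function.Surjective.iSup_congr (crFlip K q)
    (fun β => ⟨crFlip K q β, crFlip_flip K q β⟩) fun β => ?_
  refine Finset.sum_congr rfl fun i _ => ?_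
  rw [← Equiv.sum_comp (Equiv.swap (⟨K - 1, by omega⟩ : Fin (K + 1)) (Fin.last K))
    (fun j => Y i (σ₁ j) * Real.log (crPi m K q a β i j))]
  refine Finset.sum_congr rfl fun j _ => ?_
  rw [crPi_flip m K hK, Equiv.Perm.mul_apply]
end
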